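/- There exists an R_f-submodule J of Q_f with I_f^#·J = R_f (i.e., the ideal I_f^# of R_f is invertible) if and only if gcd(f_0, f_1, …, f_n) = 1 (i.e., the form f is primitive). -/

import Mathlib

open Polynomial

noncomputable section

/-- The polynomial `f₀ Tⁿ + f₁ Tⁿ⁻¹ + ⋯ + fₙ` over `ℚ`. -/
def fpoly (n : ℕ) (f : ℕ → ℤ) : Polynomial ℚ :=
  ∑ i ∈ Finset.range (n + 1), Polynomial.C (f i : ℚ) * Polynomial.X ^ (n - i)

/-- `Q_f = ℚ[T]/(f₀ Tⁿ + ⋯ + fₙ)`. -/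
abbrev Qf (n : ℕ) (f : ℕ → ℤ) := AdjoinRoot (fpoly n f)

/-- `θ`, the image of `T` in `Q_f`. -/
def th (n : ℕ) (f : ℕ → ℤ) : Qf n f := AdjoinRoot.root _

/-- `ζ₀ = 1`, and `ζ_k = f₀ θ^k + f₁ θ^(k-1) + ⋯ + f_(k-1) θ` for `k ≥ 1`. -/
def zeta (n : ℕ) (f : ℕ → ℤ) (k : ℕ) : Qf n f :=
  if k = 0 then 1 else ∑ i ∈ Finset.range k, (f i : Qf n f) * th n f ^ (k - i)

/-- `R_f`, the ℤ-span of `ζ₀, …, ζ_(n-1)` in `Q_f`. -/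
def Rf (n : ℕ) (f : ℕ → ℤ) : Submodule ℤ (Qf n f) :=
  Submodule.span ℤ (Set.range fun k : Fin n => zeta n f k)

/-- `I_f^#`, the ℤ-span of `f₀, f₀θ + f₁, …, f₀θ^(n-1) + f₁θ^(n-2) + ⋯ + f_(n-1)`. -/
def Ish (n : ℕ) (f : ℕ → ℤ) : Submodule ℤ (Qf n f) :=
  Submodule.span ℤ (Set.range fun j : Fin n =>
    ∑ i ∈ Finset.range ((j : ℕ) + 1), (f i : Qf n f) * th n f ^ ((j : ℕ) - i))

/-- The partial Horner sum `f₀ θ^k + f₁ θ^(k-1) + ⋯ + f_k`. -/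
def horner (n : ℕ) (f : ℕ → ℤ) (k : ℕ) : Qf n f :=
  ∑ i ∈ Finset.range (k + 1), (f i : Qf n f) * th n f ^ (k - i)

theorem horner_zero (n : ℕ) (f : ℕ → ℤ) : horner n f 0 = f 0 := by
  simp [horner]

theorem horner_succ (n : ℕ) (f : ℕ → ℤ) (k : ℕ) :
    horner n f (k + 1) = th n f * horner n f k + f (k + 1) := by
  unfold horner
  rw [Finset.sum_range_succ, Finset.mul_sum]
  congr 1
  · refine Finset.sum_congr rfl fun i hi => ?_
    have hik : i ≤ k := Nat.lt_succ_iff.mp (Finset.mem_range.mp hi)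
    rw [Nat.succ_sub hik, pow_succ]
    ring
  · simp

theorem horner_self (n : ℕ) (f : ℕ → ℤ) : horner n f n = 0 := by
  have h : AdjoinRoot.mk (fpoly n f) (∑ i ∈ Finset.range (n + 1),
      Polynomial.C (f i : ℚ) * Polynomial.X ^ (n - i)) = 0 := AdjoinRoot.mk_self
  simpa [horner, th] using h

theorem horner_eq_zeta_add (n : ℕ) (f : ℕ → ℤ) {k : ℕ} (hk : k ≠ 0) :
    horner n f k = zeta n f k + f k := by
  simp [horner, zeta, hk, Finset.sum_range_succ]

theorem intCast_mul_mem {A : Type*} [Ring A] (M : Submodule ℤ A) (m : ℤ) {x : A}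
    (hx : x ∈ M) : (m : A) * x ∈ M := by
  simpa [zsmul_eq_mul] using M.smul_mem m hx

theorem zeta_mem_Rf {n : ℕ} (f : ℕ → ℤ) {k : ℕ} (hk : k < n) : zeta n f k ∈ Rf n f :=
  Submodule.subset_span ⟨⟨k, hk⟩, rfl⟩

theorem one_mem_Rf {n : ℕ} (f : ℕ → ℤ) (hn : 0 < n) : (1 : Qf n f) ∈ Rf n f := by
  simpa [zeta] using zeta_mem_Rf f hn

theorem intCast_mem_Rf {n : ℕ} (f : ℕ → ℤ) (hn : 0 < n) (m : ℤ) : (m : Qf n f) ∈ Rf n f := by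
  simpa using intCast_mul_mem _ m (one_mem_Rf f hn)

theorem horner_mem_Rf {n : ℕ} (f : ℕ → ℤ) (hn : 0 < n) {k : ℕ} (hk : k ≤ n) :
    horner n f k ∈ Rf n f := by
  rcases hk.eq_or_lt with rfl | hk
  · simp [horner_self]
  rcases eq_or_ne k 0 with rfl | h0
  · exact horner_zero n f ▸ intCast_mem_Rf f hn _
  · rw [horner_eq_zeta_add n f h0]
    exact add_mem (zeta_mem_Rf f hk) (intCast_mem_Rf f hn _)

theorem horner_mul_horner_mem_Rf {n : ℕ} (f : ℕ → ℤ) (hn : 0 < n) (j : ℕ) :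
    ∀ i, i ≤ n → j ≤ n → horner n f i * horner n f j ∈ Rf n f := by
  induction j with
  | zero =>
    intro i hi _
    rw [horner_zero, mul_comm]
    exact intCast_mul_mem _ _ (horner_mem_Rf f hn hi)
  | succ j ih =>
    intro i hi hj
    rcases hi.eq_or_lt with rfl | hi'
    · simp [horner_self]
    have key : horner n f i * horner n f (j + 1) = horner n f (i + 1) * horner n f j
        + f (j + 1) * horner n f i - f (i + 1) * horner n f j := by
      rw [horner_succ, horner_succ]
      ring
    rw [key]
    exact sub_mem (add_mem (ih _ hi' (by omega))
      (intCast_mul_mem _ _ (horner_mem_Rf f hn hi)))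
      (intCast_mul_mem _ _ (horner_mem_Rf f hn (by omega)))

theorem Rf_mul_self {n : ℕ} (f : ℕ → ℤ) (hn : 0 < n) : Rf n f * Rf n f = Rf n f := by
  refine le_antisymm ?_ fun x hx => by simpa using Submodule.mul_mem_mul (one_mem_Rf f hn) hx
  conv_lhs => rw [Rf, Submodule.span_mul_span]
  rw [Submodule.span_le]
  rintro _ ⟨_, ⟨⟨i, hi⟩, rfl⟩, _, ⟨⟨j, hj⟩, rfl⟩, rfl⟩
  change zeta n f i * zeta n f j ∈ Rf n f
  rcases eq_or_ne i 0 with rfl | hi0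
  · simpa [zeta] using zeta_mem_Rf f hj
  rcases eq_or_ne j 0 with rfl | hj0
  · simpa [zeta] using zeta_mem_Rf f hi
  have key : zeta n f i * zeta n f j = horner n f i * horner n f j
      - f j * horner n f i - f i * horner n f j + (f i * f j : ℤ) := by
    rw [horner_eq_zeta_add n f hi0, horner_eq_zeta_add n f hj0]
    push_cast
    ring
  rw [key]
  exact add_mem (sub_mem (sub_mem (horner_mul_horner_mem_Rf f hn j i hi.le hj.le)
    (intCast_mul_mem _ _ (horner_mem_Rf f hn hi.le)))
    (intCast_mul_mem _ _ (horner_mem_Rf f hn hj.le))) (intCast_mem_Rf f hn _)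

theorem horner_mem_Ish {n : ℕ} (f : ℕ → ℤ) {k : ℕ} (hk : k ≤ n) :
    horner n f k ∈ Ish n f := by
  rcases hk.eq_or_lt with rfl | hk
  · simp [horner_self]
  · exact Submodule.subset_span ⟨⟨k, hk⟩, rfl⟩

theorem Ish_mul_span_one_th {n : ℕ} (f : ℕ → ℤ) (hn : 0 < n)
    (hf : Finset.gcd (Finset.range (n + 1)) f = 1) :
    Ish n f * Submodule.span ℤ {1, th n f} = Rf n f := by
  set J : Submodule ℤ (Qf n f) := Submodule.span ℤ {1, th n f} with hJ
  have one_mem : (1 : Qf n f) ∈ J := Submodule.subset_span (by simp)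
  have th_mem : th n f ∈ J := Submodule.subset_span (by simp)
  have horner_mem {k : ℕ} (hk : k ≤ n) : horner n f k ∈ Ish n f * J := by
    simpa using Submodule.mul_mem_mul (horner_mem_Ish f hk) one_mem
  apply le_antisymm
  · rw [hJ, Ish, Submodule.span_mul_span, Submodule.span_le]
    rintro _ ⟨_, ⟨⟨i, hi⟩, rfl⟩, y, hy, rfl⟩
    change horner n f i * y ∈ Rf n f
    rcases hy with rfl | rfl
    · simpa using horner_mem_Rf f hn hi.le
    · have key : horner n f i * th n f = horner n f (i + 1) - (f (i + 1) : ℤ) := by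
        rw [horner_succ]
        ring
      rw [key]
      exact sub_mem (horner_mem_Rf f hn hi) (intCast_mem_Rf f hn _)
  · have coeff_mem {k : ℕ} (hk : k ≤ n) : (f k : Qf n f) ∈ Ish n f * J := by
      cases k with
      | zero => simpa [horner_zero] using horner_mem hk
      | succ k =>
        have key : (f (k + 1) : Qf n f) = horner n f (k + 1) - horner n f k * th n f := by
          rw [horner_succ]
          ring
        rw [key]
        exact sub_mem (horner_mem hk)
          (Submodule.mul_mem_mul (horner_mem_Ish f (Nat.le_of_succ_le hk)) th_mem)
    have one_mem' : (1 : Qf n f) ∈ Ish n f * J := by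
      obtain ⟨g, hg⟩ := Finset.gcd_eq_sum_mul (Finset.range (n + 1)) f
      have h : (1 : Qf n f) = ∑ i ∈ Finset.range (n + 1), (g i : Qf n f) * f i := by
        rw [hf] at hg
        exact_mod_cast congrArg (Int.cast : ℤ → Qf n f) (by simpa [mul_comm] using hg)
      rw [h]
      exact sum_mem fun i hi =>
        intCast_mul_mem _ _ (coeff_mem (Nat.lt_succ_iff.mp (Finset.mem_range.mp hi)))
    rw [Rf, Submodule.span_le]
    rintro _ ⟨⟨k, hk⟩, rfl⟩
    change zeta n f k ∈ Ish n f * J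
    rcases eq_or_ne k 0 with rfl | h0
    · simpa [zeta] using one_mem'
    · rw [← add_sub_cancel_right (zeta n f k) (f k : Qf n f), ← horner_eq_zeta_add n f h0]
      exact sub_mem (horner_mem hk.le) (coeff_mem hk.le)

theorem coeff_fpoly_self (n : ℕ) (f : ℕ → ℤ) : (fpoly n f).coeff n = f 0 := by
  rw [fpoly, Polynomial.finsetSum_coeff, Finset.sum_eq_single 0]
  · simp
  · intro i hi hi0
    rw [Finset.mem_range] at hi
    rw [Polynomial.coeff_C_mul_X_pow, if_neg (by omega)]
  · simp

theorem natDegree_fpoly (n : ℕ) {f : ℕ → ℤ} (hf0 : f 0 ≠ 0) : (fpoly n f).natDegree = n := by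
  apply Polynomial.natDegree_eq_of_le_of_coeff_ne_zero
  · refine Polynomial.natDegree_sum_le_of_forall_le _ _ fun i _ => ?_
    exact (Polynomial.natDegree_C_mul_X_pow_le _ _).trans (Nat.sub_le _ _)
  · simpa [coeff_fpoly_self] using hf0

theorem linearIndependent_zeta (n : ℕ) {f : ℕ → ℤ} (hf0 : f 0 ≠ 0) :
    LinearIndependent ℚ fun k : Fin n => zeta n f k := by
  have hne : fpoly n f ≠ 0 := by
    intro h
    have hc := coeff_fpoly_self n f
    rw [h] at hc
    exact hf0 (by simpa using hc.symm)
  let pb := AdjoinRoot.powerBasis hne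
  have hdim : pb.dim = n := by simp [pb, natDegree_fpoly n hf0]
  have pow_mem : ∀ k, k < n → th n f ^ k ∈
      Submodule.span ℚ (Set.range fun k : Fin n => zeta n f k) := by
    intro k
    induction k using Nat.strong_induction_on with
    | _ k ih =>
      intro hk
      have hz : zeta n f k ∈ Submodule.span ℚ (Set.range fun k : Fin n => zeta n f k) :=
        Submodule.subset_span ⟨⟨k, hk⟩, rfl⟩
      rcases eq_or_ne k 0 with rfl | h0
      · simpa [zeta] using hz
      obtain ⟨m, rfl⟩ := Nat.exists_eq_succ_of_ne_zero h0
      rw [zeta, if_neg h0, Finset.sum_range_succ'] at hz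
      have hsum : ∑ i ∈ Finset.range m, (f (i + 1) : Qf n f) * th n f ^ (m + 1 - (i + 1)) ∈
          Submodule.span ℚ (Set.range fun k : Fin n => zeta n f k) := by
        refine sum_mem fun i hi => ?_
        have := Submodule.smul_mem _ (f (i + 1) : ℚ) (ih (m + 1 - (i + 1)) (by omega) (by omega))
        simpa [Algebra.smul_def] using this
      have h := Submodule.smul_mem _ ((f 0 : ℚ)⁻¹) ((Submodule.add_mem_iff_right _ hsum).mp hz)
      have hcast : ((f 0 : ℤ) : Qf n f) = algebraMap ℚ _ (f 0 : ℚ) := by simp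
      rw [hcast, ← Algebra.smul_def, smul_smul, inv_mul_cancel₀ (by exact_mod_cast hf0),
        one_smul] at h
      simpa using h
  refine linearIndependent_of_top_le_span_of_card_eq_finrank ?_ ?_
  · rw [← pb.basis.span_eq, Submodule.span_le]
    rintro _ ⟨k, rfl⟩
    simpa [pb, th] using pow_mem k (k.2.trans_eq hdim)
  · rw [pb.finrank, hdim, Fintype.card_fin]

theorem mul_th_mul_mem_Ish {n : ℕ} {f g : ℕ → ℤ} {c : ℤ} (hn : 0 < n)
    (hg : ∀ i ≤ n, f i = c * g i) {x : Qf n f} (hx : x ∈ Ish n f) :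
    (g 0 : Qf n f) * th n f * x ∈ Ish n f := by
  have comm {k : ℕ} (hk : k ≤ n) : (g 0 : Qf n f) * f k = g k * f 0 := by
    rw [hg k hk, hg 0 (Nat.zero_le _)]
    push_cast
    ring
  induction hx using Submodule.span_induction with
  | mem x hx =>
    obtain ⟨⟨i, hi⟩, rfl⟩ := hx
    change (g 0 : Qf n f) * th n f * horner n f i ∈ Ish n f
    have key : (g 0 : Qf n f) * th n f * horner n f i =
        g 0 * horner n f (i + 1) - g (i + 1) * horner n f 0 := by
      rw [horner_succ, horner_zero, ← comm hi]
      ring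
    rw [key]
    exact sub_mem (intCast_mul_mem _ _ (horner_mem_Ish f hi))
      (intCast_mul_mem _ _ (horner_mem_Ish f hn.le))
  | zero => simp
  | add x y _ _ hx hy => rw [mul_add]; exact add_mem hx hy
  | smul a x _ hx => rw [mul_smul_comm]; exact Submodule.smul_mem _ _ hx

theorem isUnit_of_mul_th_mem_Rf {n : ℕ} {f g : ℕ → ℤ} {c : ℤ} (hn : 2 ≤ n) (hf0 : f 0 ≠ 0)
    (hg : f 0 = c * g 0) (h : (g 0 : Qf n f) * th n f ∈ Rf n f) : IsUnit c := by
  obtain ⟨a, ha⟩ := (Submodule.mem_span_range_iff_exists_fun ℤ).mp h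
  have hz : zeta n f 1 = ∑ k : Fin n, ((c * a k : ℤ) : ℚ) • zeta n f k := by
    have h1 : zeta n f 1 = c • ((g 0 : Qf n f) * th n f) := by
      simp [zeta, hg, mul_assoc]
    rw [h1, ← ha, Finset.smul_sum]
    refine Finset.sum_congr rfl fun k _ => ?_
    rw [Int.cast_smul_eq_zsmul, mul_smul]
  let e : Fin n := ⟨1, hn⟩
  have hs : ∑ k : Fin n, (Pi.single e 1 : Fin n → ℚ) k • zeta n f k = zeta n f 1 := by
    rw [Finset.sum_eq_single e]
    · simp [e]
    · intro b _ hb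
      simp [hb]
    · simp
  have hli := (Fintype.linearIndependent_iffₛ.mp (linearIndependent_zeta n hf0))
    (fun k => ((c * a k : ℤ) : ℚ)) (Pi.single e 1) (hz.symm.trans hs.symm) e
  rw [Pi.single_eq_same] at hli
  exact IsUnit.of_mul_eq_one (a e) (by exact_mod_cast hli)

/-- The ideal `I_f^#` of `R_f` is invertible (there is an `R_f`-submodule `J` of `Q_f`
with `I_f^# · J = R_f`) if and only if `gcd(f₀, …, f_n) = 1`, i.e. `f` is primitive. -/
theorem stmt9 (n : ℕ) (hn : 2 ≤ n) (f : ℕ → ℤ) (hf0 : f 0 ≠ 0) :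
    (∃ J : Submodule ℤ (Qf n f),
        (∀ r ∈ Rf n f, ∀ x ∈ J, r * x ∈ J) ∧ Ish n f * J = Rf n f) ↔
      Finset.gcd (Finset.range (n + 1)) f = 1 := by
  have hn0 : 0 < n := by omega
  constructor
  · rintro ⟨J, -, hIJ⟩
    set c := Finset.gcd (Finset.range (n + 1)) f
    have hdvd : ∀ i, i ≤ n → c ∣ f i := fun i hi =>
      Finset.gcd_dvd (Finset.mem_range.mpr (Nat.lt_succ_of_le hi))
    have hg : ∀ i ≤ n, f i = c * (f i / c) := fun i hi => (Int.mul_ediv_cancel' (hdvd i hi)).symm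
    have hstable : ∀ x ∈ Ish n f * J, ((f 0 / c : ℤ) : Qf n f) * th n f * x ∈ Ish n f * J := by
      intro x hx
      induction hx using Submodule.mul_induction_on' with
      | mem_mul_mem x hx y hy =>
        rw [← mul_assoc]
        exact Submodule.mul_mem_mul
          (mul_th_mul_mem_Ish (g := fun i => f i / c) hn0 hg hx) hy
      | add x _ y _ hx hy => rw [mul_add]; exact add_mem hx hy
    rw [hIJ] at hstable
    have hmem := hstable 1 (one_mem_Rf f hn0)
    rw [mul_one] at hmem
    have hunit : IsUnit c :=
      isUnit_of_mul_th_mem_Rf (g := fun i => f i / c) hn hf0 (hg 0 hn0.le) hmem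
    exact Finset.normalize_gcd.symm.trans (normalize_eq_one.mpr hunit)
  · intro hf
    refine ⟨Submodule.span ℤ {1, th n f} * Rf n f, fun r hr x hx => ?_, ?_⟩
    · have h := Submodule.mul_mem_mul hx hr
      rwa [mul_assoc, Rf_mul_self f hn0, mul_comm x] at h
    · rw [← mul_assoc, Ish_mul_span_one_th f hn0 hf, Rf_mul_self f hn0]

end
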